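/- arXiv:2112.13887 — 2 statements merged into one kernel-verified Lean document; each statement's English description precedes it below -/
import Mathlib

section
/- Let U be an open subset of ℝⁿ and let P₁, P₂ : U → GL(n,ℝ) be twice continuously differentiable frame fields with associated connection coefficients Γᵢ and non-uniformity tensor B = Γ₁ − Γ₂. If v, w : U → ℝⁿ are continuously differentiable vector fields lying pointwise in the null space of B (that is, Σ_K B^I_{JK}(X) v^K(X) = 0 and Σ_K B^I_{JK}(X) w^K(X) = 0 for all X ∈ U and all indices I, J), then the Lie bracket [v,w] also lies pointwise in the null space of B: Σ_K B^I_{JK}(X) [v,w]^K(X) = 0 for all X ∈ U and all I, J. Consequently, any regular distribution generated by the null spaces of B is involutive. -/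
open scoped BigOperators

/-- Partial derivative of a scalar field on `ℝⁿ` in the `K`-th coordinate direction. -/
noncomputable def pd {n : ℕ} (f : (Fin n → ℝ) → ℝ) (K : Fin n) (x : Fin n → ℝ) : ℝ :=
  fderiv ℝ f x (Pi.single K 1)

/-- Connection coefficients `Γ^I_{JK} = −Σ_α (∂_K P^I_α)(P⁻¹)^α_J` associated with a
frame field `P` (with pointwise inverse `Pinv`). -/
noncomputable def conn {n : ℕ} (P Pinv : (Fin n → ℝ) → Matrix (Fin n) (Fin n) ℝ)
    (I J K : Fin n) (x : Fin n → ℝ) : ℝ :=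
  -∑ α, pd (fun y => P y I α) K x * Pinv x α J

/-- The entrywise directional derivative at `x` along `u` of a matrix-valued map. -/
noncomputable def matrixDeriv {n : ℕ} (P : (Fin n → ℝ) → Matrix (Fin n) (Fin n) ℝ)
    (x u : Fin n → ℝ) : Matrix (Fin n) (Fin n) ℝ :=
  Matrix.of fun I J => fderiv ℝ (fun y => P y I J) x u

theorem matrixDeriv_mul {n : ℕ} {P Q : (Fin n → ℝ) → Matrix (Fin n) (Fin n) ℝ}
    {x : Fin n → ℝ} (hP : ∀ I J, DifferentiableAt ℝ (fun y => P y I J) x)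
    (hQ : ∀ I J, DifferentiableAt ℝ (fun y => Q y I J) x) (u : Fin n → ℝ) :
    matrixDeriv (fun y => P y * Q y) x u =
      matrixDeriv P x u * Q x + P x * matrixDeriv Q x u := by
  ext I J
  simp only [matrixDeriv, Matrix.of_apply, Matrix.mul_apply, Matrix.add_apply]
  rw [fderiv_fun_sum fun i _ => (hP I i).fun_mul (hQ i J), sum_apply,
    ← Finset.sum_add_distrib]
  refine Finset.sum_congr rfl fun i _ => ?_
  rw [fderiv_fun_mul (hP I i) (hQ i J)]
  simp only [add_apply, smul_apply, smul_eq_mul]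
  ring

theorem sum_mul_pd {n : ℕ} (f : (Fin n → ℝ) → ℝ) (x u : Fin n → ℝ) :
    ∑ K, u K * pd f K x = fderiv ℝ f x u := by
  conv_rhs => rw [pi_eq_sum_univ' u]
  simp [pd, map_sum]

theorem sum_conn_mul {n : ℕ} (P Pinv : (Fin n → ℝ) → Matrix (Fin n) (Fin n) ℝ)
    (I J : Fin n) (x u : Fin n → ℝ) :
    ∑ K, conn P Pinv I J K x * u K = -(matrixDeriv P x u * Pinv x) I J := by
  simp only [conn, Matrix.mul_apply, matrixDeriv, Matrix.of_apply, ← sum_mul_pd, neg_mul,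
    Finset.sum_neg_distrib, Finset.sum_mul]
  rw [Finset.sum_comm]
  congr 1
  exact Finset.sum_congr rfl fun _ _ => Finset.sum_congr rfl fun _ _ => by ring

theorem contDiffOn_matrix_det {n : ℕ} {m : ℕ} {k : WithTop ℕ∞} {U : Set (Fin n → ℝ)}
    {P : (Fin n → ℝ) → Matrix (Fin m) (Fin m) ℝ}
    (hP : ∀ I J, ContDiffOn ℝ k (fun x => P x I J) U) :
    ContDiffOn ℝ k (fun x => (P x).det) U := by
  simp only [Matrix.det_apply']
  exact ContDiffOn.sum fun σ _ =>
    contDiffOn_const.mul (contDiffOn_prod fun i _ => hP (σ i) i)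

theorem contDiffOn_matrix_inv {n : ℕ} {k : WithTop ℕ∞} {U : Set (Fin n → ℝ)}
    {P Pinv : (Fin n → ℝ) → Matrix (Fin n) (Fin n) ℝ}
    (hP : ∀ I J, ContDiffOn ℝ k (fun x => P x I J) U)
    (hPinv : ∀ x ∈ U, P x * Pinv x = 1) (I J : Fin n) :
    ContDiffOn ℝ k (fun x => Pinv x I J) U := by
  have hdet : ∀ x ∈ U, (P x).det ≠ 0 := fun x hx h => by
    simpa [h] using congrArg Matrix.det (hPinv x hx)
  have hadj : ContDiffOn ℝ k (fun x => (P x).adjugate I J) U := by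
    simp only [Matrix.adjugate_apply]
    refine contDiffOn_matrix_det fun a b => ?_
    by_cases h : a = J
    · simpa [Matrix.updateRow_apply, h] using contDiffOn_const
    · simpa [Matrix.updateRow_apply, h] using hP a b
  refine (((contDiffOn_matrix_det hP).inv hdet).mul hadj).congr fun x hx => ?_
  rw [← Matrix.inv_eq_right_inv (hPinv x hx), Matrix.inv_def]
  simp

/-- If a `C²` function is constant along two `C¹` vector fields, then it is constant along their
Lie bracket. -/
theorem fderiv_lieBracket_eq_zero {E : Type*} [NormedAddCommGroup E] [NormedSpace ℝ E]
    {U : Set E} (hU : IsOpen U) {q : E → ℝ} {v w : E → E} (hq : ContDiffOn ℝ 2 q U)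
    (hv : DifferentiableOn ℝ v U) (hw : DifferentiableOn ℝ w U)
    (hqv : ∀ x ∈ U, fderiv ℝ q x (v x) = 0) (hqw : ∀ x ∈ U, fderiv ℝ q x (w x) = 0)
    {x : E} (hx : x ∈ U) : fderiv ℝ q x (VectorField.lieBracket ℝ v w x) = 0 := by
  have hUx := hU.mem_nhds hx
  have hqx := hq.contDiffAt hUx
  have hdq : DifferentiableAt ℝ (fderiv ℝ q) x :=
    (hqx.fderiv_right (m := 1) (by norm_num)).differentiableAt (by norm_num)
  have key : ∀ z : E → E, DifferentiableOn ℝ z U → (∀ y ∈ U, fderiv ℝ q y (z y) = 0) →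
      ∀ u, fderiv ℝ q x (fderiv ℝ z x u) = -fderiv ℝ (fderiv ℝ q) x u (z x) := by
    intro z hz hqz u
    have h₀ : (fun y => fderiv ℝ q y (z y)) =ᶠ[nhds x] fun _ => 0 :=
      Filter.eventuallyEq_of_mem hUx hqz
    have h₁ := congrArg (fun L => L u) (fderiv_clm_apply hdq (hz.differentiableAt hUx))
    rw [h₀.fderiv_eq] at h₁
    simp at h₁
    linarith
  have hsymm := (hqx.isSymmSndFDerivAt (by simp)).eq (v x) (w x)
  rw [VectorField.lieBracket_eq, map_sub, key w hw hqw, key v hv hqv, hsymm, sub_self]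

/-- For invertible frame fields, the difference of the connections contracted with `u` is the
derivative of the transition matrix `P₁⁻¹ P₂` along `u`, conjugated by the frames. -/
theorem matrixDeriv_inv_mul {n : ℕ} {U : Set (Fin n → ℝ)} (hU : IsOpen U)
    {P₁ P₂ Q₁ Q₂ : (Fin n → ℝ) → Matrix (Fin n) (Fin n) ℝ} {x : Fin n → ℝ} (hx : x ∈ U)
    (hP₁ : ∀ I J, DifferentiableAt ℝ (fun y => P₁ y I J) x)
    (hP₂ : ∀ I J, DifferentiableAt ℝ (fun y => P₂ y I J) x)
    (hQ₁ : ∀ I J, DifferentiableAt ℝ (fun y => Q₁ y I J) x)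
    (h₁ : ∀ y ∈ U, Q₁ y * P₁ y = 1) (h₁' : P₁ x * Q₁ x = 1) (h₂ : Q₂ x * P₂ x = 1)
    (u : Fin n → ℝ) :
    matrixDeriv (fun y => Q₁ y * P₂ y) x u =
      Q₁ x * (matrixDeriv P₂ x u * Q₂ x - matrixDeriv P₁ x u * Q₁ x) * P₂ x := by
  have h₀ : matrixDeriv (fun y => Q₁ y * P₁ y) x u = 0 := by
    ext I J
    have : (fun y => (Q₁ y * P₁ y) I J) =ᶠ[nhds x] fun _ => (1 : Matrix _ _ ℝ) I J :=
      Filter.eventuallyEq_of_mem (hU.mem_nhds hx) fun y hy => by simp only [h₁ y hy]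
    simp [matrixDeriv, this.fderiv_eq]
  rw [matrixDeriv_mul hQ₁ hP₁] at h₀
  have hE : matrixDeriv Q₁ x u = -(Q₁ x * matrixDeriv P₁ x u) * Q₁ x := by
    rw [← eq_neg_of_add_eq_zero_left h₀, mul_assoc, h₁', mul_one]
  rw [matrixDeriv_mul hQ₁ hP₂, hE, mul_sub, sub_mul]
  simp only [mul_assoc, h₂, mul_one, neg_mul]
  abel

/-- If `v` and `w` are `C¹` vector fields lying pointwise in the null
space of the non-uniformity tensor `B = Γ₁ − Γ₂` of two `C²` frame fields on an open set
`U ⊆ ℝⁿ`, then their Lie bracket `[v,w]^K = Σ_L (v^L ∂_L w^K − w^L ∂_L v^K)` also lies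
pointwise in the null space of `B`; hence any regular distribution generated by the null
spaces of `B` is involutive. -/
theorem null_space_involutive {n : ℕ} (U : Set (Fin n → ℝ)) (hU : IsOpen U)
    (P₁ P₂ Pinv₁ Pinv₂ : (Fin n → ℝ) → Matrix (Fin n) (Fin n) ℝ)
    (hP₁ : ∀ I α, ContDiffOn ℝ 2 (fun x => P₁ x I α) U)
    (hP₂ : ∀ I α, ContDiffOn ℝ 2 (fun x => P₂ x I α) U)
    (hPinv₁ : ∀ x ∈ U, P₁ x * Pinv₁ x = 1 ∧ Pinv₁ x * P₁ x = 1)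
    (hPinv₂ : ∀ x ∈ U, P₂ x * Pinv₂ x = 1 ∧ Pinv₂ x * P₂ x = 1)
    (B : Fin n → Fin n → Fin n → (Fin n → ℝ) → ℝ)
    (hB : ∀ I J K x, B I J K x = conn P₁ Pinv₁ I J K x - conn P₂ Pinv₂ I J K x)
    (v w : (Fin n → ℝ) → (Fin n → ℝ))
    (hv : ∀ K, ContDiffOn ℝ 1 (fun x => v x K) U)
    (hw : ∀ K, ContDiffOn ℝ 1 (fun x => w x K) U)
    (hvB : ∀ x ∈ U, ∀ I J, ∑ K, B I J K x * v x K = 0)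
    (hwB : ∀ x ∈ U, ∀ I J, ∑ K, B I J K x * w x K = 0) :
    ∀ x ∈ U, ∀ I J,
      ∑ K, B I J K x *
        (∑ L, (v x L * pd (fun y => w y K) L x - w x L * pd (fun y => v y K) L x)) = 0 := by
  have hQ₁ := contDiffOn_matrix_inv hP₁ fun x hx => (hPinv₁ x hx).1
  have hdiff : ∀ {f : (Fin n → ℝ) → ℝ}, ContDiffOn ℝ 2 f U →
      ∀ {x}, x ∈ U → DifferentiableAt ℝ f x := fun hf _ hx =>
    (hf.contDiffAt (hU.mem_nhds hx)).differentiableAt (by norm_num)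
  have hsum : ∀ (x u : Fin n → ℝ) (I J : Fin n), ∑ K, B I J K x * u K =
      (matrixDeriv P₂ x u * Pinv₂ x - matrixDeriv P₁ x u * Pinv₁ x) I J := by
    intro x u I J
    simp only [hB, sub_mul, Finset.sum_sub_distrib, sum_conn_mul, Matrix.sub_apply]
    ring
  have htrans : ∀ x ∈ U, ∀ u, matrixDeriv (fun y => Pinv₁ y * P₂ y) x u =
      Pinv₁ x * (matrixDeriv P₂ x u * Pinv₂ x - matrixDeriv P₁ x u * Pinv₁ x) * P₂ x :=
    fun x hx u => matrixDeriv_inv_mul hU hx (fun I J => hdiff (hP₁ I J) hx)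
      (fun I J => hdiff (hP₂ I J) hx) (fun I J => hdiff (hQ₁ I J) hx)
      (fun y hy => (hPinv₁ y hy).2) (hPinv₁ x hx).1 (hPinv₂ x hx).2 u
  have hnull : ∀ x ∈ U, ∀ u : Fin n → ℝ, (∀ I J, ∑ K, B I J K x * u K = 0) ↔
      ∀ I J, fderiv ℝ (fun y => (Pinv₁ y * P₂ y) I J) x u = 0 := by
    intro x hx u
    have hl : (∀ I J, ∑ K, B I J K x * u K = 0) ↔
        matrixDeriv P₂ x u * Pinv₂ x - matrixDeriv P₁ x u * Pinv₁ x = 0 := by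
      simp only [hsum, ← Matrix.ext_iff, Matrix.zero_apply]
    have hr : (∀ I J, fderiv ℝ (fun y => (Pinv₁ y * P₂ y) I J) x u = 0) ↔
        matrixDeriv (fun y => Pinv₁ y * P₂ y) x u = 0 := by
      simp only [← Matrix.ext_iff, matrixDeriv, Matrix.of_apply, Matrix.zero_apply]
    rw [hl, hr, htrans x hx u]
    refine ⟨fun h => by rw [h, mul_zero, zero_mul], fun h => ?_⟩
    have h' := congrArg (fun M => P₁ x * M * Pinv₂ x) h
    simpa only [mul_assoc, (hPinv₂ x hx).1, mul_one, ← mul_assoc (P₁ x) (Pinv₁ x),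
      (hPinv₁ x hx).1, one_mul, mul_zero, zero_mul] using h'
  have hv' : DifferentiableOn ℝ v U :=
    differentiableOn_pi.2 fun K => (hv K).differentiableOn (by norm_num)
  have hw' : DifferentiableOn ℝ w U :=
    differentiableOn_pi.2 fun K => (hw K).differentiableOn (by norm_num)
  intro x hx
  have hbracket : ∀ K, ∑ L, (v x L * pd (fun y => w y K) L x - w x L * pd (fun y => v y K) L x) =
      VectorField.lieBracket ℝ v w x K := by
    intro K
    have hcomp : ∀ z : (Fin n → ℝ) → (Fin n → ℝ), DifferentiableOn ℝ z U → ∀ u,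
        fderiv ℝ (fun y => z y K) x u = fderiv ℝ z x u K := fun z hz u => by
      rw [fderiv_apply (hz.differentiableAt (hU.mem_nhds hx))]
      rfl
    rw [Finset.sum_sub_distrib, sum_mul_pd, sum_mul_pd, hcomp w hw', hcomp v hv']
    rfl
  simp only [hbracket]
  refine (hnull x hx _).2 fun I J => ?_
  refine fderiv_lieBracket_eq_zero hU ?_ hv' hw'
    (fun y hy => (hnull y hy _).1 (hvB y hy) I J) (fun y hy => (hnull y hy _).1 (hwB y hy) I J) hx
  simp only [Matrix.mul_apply]
  exact ContDiffOn.sum fun i _ => (hQ₁ I i).mul (hP₂ i J)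
end

section
/- Let U be an open subset of ℝⁿ and let P : U → GL(n,ℝ) be a twice continuously differentiable frame field with connection coefficients Γ^I_{JK} = −Σ_α (∂_K P^I_α) (P⁻¹)^α_J. Then the curvature of this connection vanishes identically on U: for all indices I, J, K, L and all X ∈ U, ∂_K Γ^I_{JL} − ∂_L Γ^I_{JK} + Σ_M (Γ^I_{MK} Γ^M_{JL} − Γ^I_{ML} Γ^M_{JK}) = 0. That is, the connection induced by a smooth frame field is a distant parallelism (a flat connection). -/
open scoped BigOperators

section PartialDerivatives

variable {n : ℕ} {f g : (Fin n → ℝ) → ℝ} {x : Fin n → ℝ}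

theorem pd_congr (h : f =ᶠ[nhds x] g) (K : Fin n) : pd f K x = pd g K x := by
  rw [pd, pd, h.fderiv_eq]

theorem pd_neg (K : Fin n) : pd (fun y => -f y) K x = -pd f K x := by
  simp only [pd, fderiv_fun_neg, neg_apply]

theorem pd_mul (hf : DifferentiableAt ℝ f x) (hg : DifferentiableAt ℝ g x) (K : Fin n) :
    pd (fun y => f y * g y) K x = pd f K x * g x + f x * pd g K x := by
  simp only [pd, fderiv_fun_mul hf hg, add_apply,
    smul_apply, smul_eq_mul]
  ring

theorem pd_sum {ι : Type*} {s : Finset ι} {F : ι → (Fin n → ℝ) → ℝ}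
    (hF : ∀ i ∈ s, DifferentiableAt ℝ (F i) x) (K : Fin n) :
    pd (fun y => ∑ i ∈ s, F i y) K x = ∑ i ∈ s, pd (F i) K x := by
  simp only [pd, fderiv_fun_sum hF, sum_apply]

theorem ContDiffAt.differentiableAt_fderiv_of_two (hf : ContDiffAt ℝ 2 f x) :
    DifferentiableAt ℝ (fderiv ℝ f) x :=
  (hf.fderiv_right (m := 1) (by norm_num)).differentiableAt (by norm_num)

theorem ContDiffAt.differentiableAt_pd (hf : ContDiffAt ℝ 2 f x) (K : Fin n) :
    DifferentiableAt ℝ (pd f K) x :=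
  hf.differentiableAt_fderiv_of_two.clm_apply (differentiableAt_const _)

theorem ContDiffAt.pd_pd_comm (hf : ContDiffAt ℝ 2 f x) (K L : Fin n) :
    pd (pd f L) K x = pd (pd f K) L x := by
  have pd_pd (K L : Fin n) :
      pd (pd f L) K x = fderiv ℝ (fderiv ℝ f) x (Pi.single K 1) (Pi.single L 1) := by
    change fderiv ℝ (fun y => fderiv ℝ f y (Pi.single L 1)) x (Pi.single K 1) = _
    rw [fderiv_clm_apply hf.differentiableAt_fderiv_of_two (differentiableAt_const _)]
    simp
  rw [pd_pd, pd_pd]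
  exact hf.isSymmSndFDerivAt (by simp) _ _

end PartialDerivatives

section MatrixInverse

variable {E m : Type*} [NormedAddCommGroup E] [NormedSpace ℝ E] [Fintype m] [DecidableEq m]
  {A : E → Matrix m m ℝ} {x : E}

theorem DifferentiableAt.matrix_det (hA : ∀ i j, DifferentiableAt ℝ (fun y => A y i j) x) :
    DifferentiableAt ℝ (fun y => (A y).det) x := by
  simp only [Matrix.det_apply']
  exact DifferentiableAt.fun_sum fun σ _ => (differentiableAt_const _).mul
    (HasFDerivAt.finsetProd fun i _ => (hA (σ i) i).hasFDerivAt).differentiableAt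

theorem DifferentiableAt.matrix_adjugate (hA : ∀ i j, DifferentiableAt ℝ (fun y => A y i j) x)
    (i j : m) : DifferentiableAt ℝ (fun y => (A y).adjugate i j) x := by
  simp only [Matrix.adjugate_apply]
  refine DifferentiableAt.matrix_det fun k l => ?_
  by_cases h : k = j
  · simp [h]
  · simpa [Matrix.updateRow_ne h] using hA k l

theorem DifferentiableAt.matrix_inv (hA : ∀ i j, DifferentiableAt ℝ (fun y => A y i j) x)
    (hdet : (A x).det ≠ 0) (i j : m) : DifferentiableAt ℝ (fun y => (A y)⁻¹ i j) x := by
  simp only [Matrix.inv_def, Ring.inverse_eq_inv', Matrix.smul_apply, smul_eq_mul]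
  exact ((DifferentiableAt.matrix_det hA).inv hdet).mul (DifferentiableAt.matrix_adjugate hA i j)

end MatrixInverse

section Connection

variable {n : ℕ} {P Pinv : (Fin n → ℝ) → Matrix (Fin n) (Fin n) ℝ} {x : Fin n → ℝ}

/-- The frame is parallel for its own connection. -/
theorem sum_conn_mul_frame (h : Pinv x * P x = 1) (I α L : Fin n) :
    ∑ M, conn P Pinv I M L x * P x M α = -pd (fun y => P y I α) L x := by
  have hentry (β : Fin n) : ∑ M, Pinv x β M * P x M α = if β = α then 1 else 0 := by
    rw [← Matrix.mul_apply, h, Matrix.one_apply]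
  simp only [conn, neg_mul, Finset.sum_neg_distrib, Finset.sum_mul]
  rw [Finset.sum_comm]
  simp only [mul_assoc, ← Finset.mul_sum, hentry]
  simp

theorem differentiableAt_conn (hP : ∀ I α, ContDiffAt ℝ 2 (fun y => P y I α) x)
    (hinv : ∀ᶠ y in nhds x, P y * Pinv y = 1) (I J K : Fin n) :
    DifferentiableAt ℝ (conn P Pinv I J K) x := by
  have hdet : (P x).det ≠ 0 := (Matrix.isUnit_det_of_right_inverse hinv.self_of_nhds).ne_zero
  have hPinv (α : Fin n) : DifferentiableAt ℝ (fun y => Pinv y α J) x := by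
    refine (DifferentiableAt.matrix_inv
      (fun i j => (hP i j).differentiableAt (by norm_num)) hdet α J).congr_of_eventuallyEq ?_
    filter_upwards [hinv] with y hy
    rw [Matrix.inv_eq_right_inv hy]
  exact (DifferentiableAt.fun_sum fun α _ => ((hP I α).differentiableAt_pd K).mul (hPinv α)).neg

/-- The derivative of the parallelism equation `Γ_L P = -∂_L P` in direction `K`. -/
theorem sum_pd_conn_mul_frame (hP : ∀ I α, ContDiffAt ℝ 2 (fun y => P y I α) x)
    (hinv : ∀ᶠ y in nhds x, P y * Pinv y = 1 ∧ Pinv y * P y = 1) (I α K L : Fin n) :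
    ∑ M, pd (conn P Pinv I M L) K x * P x M α
        + ∑ M, conn P Pinv I M L x * pd (fun y => P y M α) K x
      = -pd (pd (fun y => P y I α) L) K x := by
  have hconn (M : Fin n) : DifferentiableAt ℝ (conn P Pinv I M L) x :=
    differentiableAt_conn hP (hinv.mono fun _ h => h.1) I M L
  have hframe (M : Fin n) : DifferentiableAt ℝ (fun y => P y M α) x :=
    (hP M α).differentiableAt (by norm_num)
  rw [← pd_neg, ← pd_congr (hinv.mono fun y h => sum_conn_mul_frame h.2 I α L),
    pd_sum fun M _ => (hconn M).fun_mul (hframe M), ← Finset.sum_add_distrib]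
  exact Finset.sum_congr rfl fun M _ => (pd_mul (hconn M) (hframe M) K).symm

end Connection

/-- The connection induced by a `C²` frame field `P : U → GL(n,ℝ)` on
an open set `U ⊆ ℝⁿ` has vanishing curvature:
`∂_K Γ^I_{JL} − ∂_L Γ^I_{JK} + Σ_M (Γ^I_{MK} Γ^M_{JL} − Γ^I_{ML} Γ^M_{JK}) = 0`
on `U`; i.e. a smooth frame field induces a distant parallelism (a flat connection). -/
theorem frame_connection_flat {n : ℕ} (U : Set (Fin n → ℝ)) (hU : IsOpen U)
    (P Pinv : (Fin n → ℝ) → Matrix (Fin n) (Fin n) ℝ)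
    (hP : ∀ I α, ContDiffOn ℝ 2 (fun x => P x I α) U)
    (hPinv : ∀ x ∈ U, P x * Pinv x = 1 ∧ Pinv x * P x = 1) :
    ∀ x ∈ U, ∀ I J K L,
      pd (conn P Pinv I J L) K x - pd (conn P Pinv I J K) L x
        + ∑ M, (conn P Pinv I M K x * conn P Pinv M J L x
            - conn P Pinv I M L x * conn P Pinv M J K x) = 0 := by
  intro x hx I J K L
  have hPx (I α : Fin n) : ContDiffAt ℝ 2 (fun y => P y I α) x :=
    (hP I α).contDiffAt (hU.mem_nhds hx)
  have hinv : ∀ᶠ y in nhds x, P y * Pinv y = 1 ∧ Pinv y * P y = 1 :=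
    (hU.eventually_mem hx).mono hPinv
  let Γ (K : Fin n) : Matrix (Fin n) (Fin n) ℝ := .of fun I J => conn P Pinv I J K x
  let dΓ (K L : Fin n) : Matrix (Fin n) (Fin n) ℝ := .of fun I J => pd (conn P Pinv I J L) K x
  let ddP (K L : Fin n) : Matrix (Fin n) (Fin n) ℝ :=
    .of fun I α => pd (pd (fun y => P y I α) L) K x
  have hdΓ (K L : Fin n) : dΓ K L * P x - Γ L * (Γ K * P x) = -ddP K L := by
    ext I α
    simp only [Matrix.sub_apply, Matrix.mul_apply, Matrix.neg_apply, Matrix.of_apply, Γ, dΓ, ddP,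
      sum_conn_mul_frame (hPinv x hx).2, ← sum_pd_conn_mul_frame hPx hinv, mul_neg,
      Finset.sum_neg_distrib, sub_neg_eq_add]
  have hsymm : ddP K L = ddP L K := by
    ext I α
    exact (hPx I α).pd_pd_comm K L
  have hcurv : (dΓ K L - dΓ L K + (Γ K * Γ L - Γ L * Γ K)) * P x = 0 := by
    have h := (hdΓ K L).trans ((congrArg Neg.neg hsymm).trans (hdΓ L K).symm)
    rw [← sub_eq_zero] at h
    rw [← h]
    noncomm_ring
  have hzero : dΓ K L - dΓ L K + (Γ K * Γ L - Γ L * Γ K) = 0 := by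
    simpa [Matrix.mul_assoc, (hPinv x hx).1] using congrArg (· * Pinv x) hcurv
  simpa [Matrix.mul_apply, Γ, dΓ, Finset.sum_sub_distrib] using congrFun₂ hzero I J
end
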